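/- Let M be a finite monomial set with decomposition M = M_1 ∪ … ∪ M_r into connected components, and for S ⊆ M let S̄ denote the saturation of S in M. Then {S ⊆ M : S̄ ≠ M} = Δ'_M; that is, for every S ⊆ M, the saturation of S is a proper subset of M if and only if m_S ≠ m_M or S ∩ M_i is disconnected for some i. -/

import Mathlib

noncomputable section
attribute [local instance] Classical.propDecidable

namespace MonomialRings

/-- Monomials in variables indexed by `σ`, represented by their exponent vectors. -/
abbrev Mon (σ : Type*) := σ → ℕ

/-- Two monomials have a non-trivial common factor. -/
def NCF {σ : Type*} (a b : Mon σ) : Prop := ∃ i, a i ≠ 0 ∧ b i ≠ 0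

/-- Adjacency in the graph associated to a set of monomials: edges go between distinct
monomials having a non-trivial common factor. -/
def mAdj {σ : Type*} (a b : Mon σ) : Prop := a ≠ b ∧ NCF a b

/-- `a` and `b` are joined by a path inside `S`. -/
def ConnIn {σ : Type*} (S : Finset (Mon σ)) (a b : Mon σ) : Prop :=
  a ∈ S ∧ b ∈ S ∧ Relation.ReflTransGen (fun u v => u ∈ S ∧ v ∈ S ∧ mAdj u v) a b

/-- A monomial set is connected (in particular nonempty). -/
def IsConnected {σ : Type*} (S : Finset (Mon σ)) : Prop :=
  S.Nonempty ∧ ∀ a ∈ S, ∀ b ∈ S, ConnIn S a b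

/-- The connected component of `a` in `S`. -/
def compOf {σ : Type*} (S : Finset (Mon σ)) (a : Mon σ) : Finset (Mon σ) :=
  S.filter (fun b => ConnIn S a b)

/-- The set of connected components of a monomial set. -/
def components {σ : Type*} (S : Finset (Mon σ)) : Finset (Finset (Mon σ)) :=
  S.image (compOf S)

/-- The number of connected components of a monomial set. -/
def ncomp {σ : Type*} (S : Finset (Mon σ)) : ℕ := (components S).card

/-- The least common multiple `m_S` of a finite set of monomials (`m_∅ = 1`). -/
def mlcm {σ : Type*} (S : Finset (Mon σ)) : Mon σ := S.sup id

/-- `S` is saturated in `M`: for all `m ∈ M` and every connected subset `T ⊆ S`,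
`m ∣ m_T` implies `m ∈ S`. -/
def Saturated {σ : Type*} (M S : Finset (Mon σ)) : Prop :=
  S ⊆ M ∧ ∀ m ∈ M, ∀ T ⊆ S, IsConnected T → m ≤ mlcm T → m ∈ S

/-- The set `sat M` of non-empty saturated subsets of `M`. -/
def satSets {σ : Type*} (M : Finset (Mon σ)) : Finset (Finset (Mon σ)) :=
  M.powerset.filter (fun S => S.Nonempty ∧ Saturated M S)

/-- The saturation `S̄` of `S` in `M`. -/
def saturation {σ : Type*} (M S : Finset (Mon σ)) : Finset (Mon σ) :=
  M.filter (fun m => ∃ C ∈ components S, m ≤ mlcm C)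

/-- The simplicial complex `Δ'_S`: faces are the `T ⊆ S` with `m_T ≠ m_S`, or such that
`S_i ∩ T` is disconnected for some connected component `S_i` of `S`. -/
def dprime {σ : Type*} (S : Finset (Mon σ)) : Set (Finset (Mon σ)) :=
  {T | T ⊆ S ∧ (mlcm T ≠ mlcm S ∨ ∃ C ∈ components S, ¬ IsConnected (C ∩ T))}

/-- The simplicial complex `Δ_N`: faces are the `S ⊆ N` with `m_S ≠ m_N` or `S`
disconnected. -/
def dcomplex {σ : Type*} (N : Finset (Mon σ)) : Set (Finset (Mon σ)) :=
  {T | T ⊆ N ∧ (mlcm T ≠ mlcm N ∨ ¬ IsConnected T)}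

/-- A discrete monomial set: the monomials are pairwise without common factors. -/
def Discrete {σ : Type*} (S : Finset (Mon σ)) : Prop :=
  ∀ a ∈ S, ∀ b ∈ S, a ≠ b → ¬ NCF a b

/-- The lcm-lattice of the monomial set `M` (as a finite set of monomials,
ordered by divisibility i.e. by `≤` on exponent vectors). -/
def lcmLattice {σ : Type*} (M : Finset (Mon σ)) : Finset (Mon σ) :=
  M.powerset.image mlcm

/-- `M_l`: the set of monomials in `M` dividing the monomial `l`. -/
def divisorsIn {σ : Type*} (M : Finset (Mon σ)) (l : Mon σ) : Finset (Mon σ) :=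
  M.filter (fun m => m ≤ l)

/-- `M_N`: the set of monomials in `M` dividing some monomial of `N`. -/
def divisorsInSet {σ : Type*} (M N : Finset (Mon σ)) : Finset (Mon σ) :=
  M.filter (fun m => ∃ l ∈ N, m ≤ l)

/-- An antichain of monomials (the minimal generating set of the monomial ideal
it generates). -/
def IsAntichain' {σ : Type*} (M : Finset (Mon σ)) : Prop :=
  ∀ m ∈ M, ∀ n ∈ M, m ≤ n → m = n

/-- total degree of a monomial -/
def mdeg {t : ℕ} (m : Mon (Fin t)) : ℕ := ∑ i, m i

end MonomialRings
open MonomialRings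

namespace MonomialRings

variable {σ : Type*} {M S T : Finset (Mon σ)} {a b c : Mon σ}

theorem NCF.symm (h : NCF a b) : NCF b a :=
  h.imp fun _ hi => hi.symm

theorem exists_ne_zero_of_two_le_mdeg {t : ℕ} {m : Mon (Fin t)} (h : 2 ≤ mdeg m) :
    ∃ i, m i ≠ 0 := by
  by_contra! h0
  simp [mdeg, h0] at h

theorem mlcm_apply (S : Finset (Mon σ)) (i : σ) : mlcm S i = S.sup fun m => m i := by
  simp [mlcm, Finset.sup_apply]

theorem le_mlcm (h : a ∈ S) : a ≤ mlcm S :=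
  Finset.le_sup (f := id) h

theorem mlcm_mono (h : S ⊆ T) : mlcm S ≤ mlcm T :=
  Finset.sup_mono h

theorem mlcm_le (h : ∀ m ∈ S, m ≤ a) : mlcm S ≤ a :=
  Finset.sup_le h

theorem exists_mem_le_apply_of_le_mlcm {n : ℕ} {i : σ} (hn : n ≠ 0) (h : n ≤ mlcm S i) :
    ∃ s ∈ S, n ≤ s i := by
  rw [mlcm_apply] at h
  exact (Finset.le_sup_iff (Nat.pos_of_ne_zero hn)).1 h

theorem exists_mem_apply_ne_zero_of_le_mlcm {i : σ} (ha : a i ≠ 0) (h : a ≤ mlcm S) :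
    ∃ s ∈ S, s i ≠ 0 := by
  obtain ⟨s, hs, hle⟩ := exists_mem_le_apply_of_le_mlcm ha (h i)
  exact ⟨s, hs, by omega⟩

theorem ConnIn.refl (h : a ∈ S) : ConnIn S a a :=
  ⟨h, h, .refl⟩

theorem ConnIn.trans (hab : ConnIn S a b) (hbc : ConnIn S b c) : ConnIn S a c :=
  ⟨hab.1, hbc.2.1, hab.2.2.trans hbc.2.2⟩

theorem ConnIn.symm (h : ConnIn S a b) : ConnIn S b a := by
  refine ⟨h.2.1, h.1, ?_⟩
  induction h.2.2 with
  | refl => exact .refl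
  | tail _ huv ih =>
    exact .head ⟨huv.2.1, huv.1, huv.2.2.1.symm, huv.2.2.2.symm⟩
      (ih ⟨h.1, huv.1, by assumption⟩)

theorem ConnIn.mono (hST : S ⊆ T) (h : ConnIn S a b) : ConnIn T a b :=
  ⟨hST h.1, hST h.2.1,
    Relation.ReflTransGen.mono (fun _ _ huv => ⟨hST huv.1, hST huv.2.1, huv.2.2⟩) _ _ h.2.2⟩

theorem ConnIn.of_ncf (ha : a ∈ S) (hb : b ∈ S) (h : NCF a b) : ConnIn S a b := by
  by_cases hab : a = b
  · exact hab ▸ .refl ha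
  · exact ⟨ha, hb, .single ⟨ha, hb, hab, h⟩⟩

theorem mem_compOf : b ∈ compOf S a ↔ ConnIn S a b := by
  simp only [compOf, Finset.mem_filter, and_iff_right_iff_imp]
  exact fun h => h.2.1

theorem mem_components {C : Finset (Mon σ)} : C ∈ components S ↔ ∃ c ∈ S, compOf S c = C :=
  Finset.mem_image

/-- A path inside `S ⊆ M` starting in a connected component of `M` stays in that component. -/
theorem ConnIn.compOf_inter (hSM : S ⊆ M) (hca : ConnIn M c a) (h : ConnIn S a b) :
    ConnIn (compOf M c ∩ S) a b := by
  have key : ∀ {x}, ConnIn S a x → x ∈ compOf M c ∩ S := fun hx =>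
    Finset.mem_inter.2 ⟨mem_compOf.2 (hca.trans (hx.mono hSM)), hx.2.1⟩
  refine ⟨key (.refl h.1), key h, ?_⟩
  obtain ⟨ha, -, hp⟩ := h
  induction hp with
  | refl => exact .refl
  | tail hau huv ih =>
    exact ih.tail ⟨key ⟨ha, huv.1, hau⟩, key ⟨ha, huv.2.1, hau.tail huv⟩, huv.2.2⟩

theorem saturation_eq_self_iff :
    saturation M S = M ↔ ∀ m ∈ M, ∃ c ∈ S, m ≤ mlcm (compOf S c) := by
  simp only [saturation, Finset.filter_eq_self, components, Finset.exists_mem_image]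

/-- If the saturation of `S` is `M`, then every monomial connected in `M` to `a ∈ S` divides
the lcm of the component of `a` in `S`. -/
theorem le_mlcm_compOf_of_connIn (hcov : ∀ m ∈ M, ∃ c ∈ S, m ≤ mlcm (compOf S c))
    (ha : a ∈ S) (h : ConnIn M a b) : b ≤ mlcm (compOf S a) := by
  obtain ⟨-, -, hp⟩ := h
  induction hp with
  | refl => exact le_mlcm (mem_compOf.2 (.refl ha))
  | tail _ huv ih =>
    obtain ⟨-, hv, -, i, hui, hvi⟩ := huv
    obtain ⟨c, -, hvc⟩ := hcov _ hv
    obtain ⟨s, hs, hsi⟩ := exists_mem_apply_ne_zero_of_le_mlcm hui ih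
    obtain ⟨s', hs', hsi'⟩ := exists_mem_apply_ne_zero_of_le_mlcm hvi hvc
    rw [mem_compOf] at hs hs'
    have hac : ConnIn S a c :=
      (hs.trans (.of_ncf hs.2.1 hs'.2.1 ⟨i, hsi, hsi'⟩)).trans hs'.symm
    exact hvc.trans (mlcm_mono fun x hx => mem_compOf.2 (hac.trans (mem_compOf.1 hx)))

theorem mlcm_eq_of_saturation_eq (hSM : S ⊆ M) (h : saturation M S = M) :
    mlcm S = mlcm M := by
  refine (mlcm_mono hSM).antisymm (mlcm_le fun m hm => ?_)
  obtain ⟨c, -, hmc⟩ := saturation_eq_self_iff.1 h m hm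
  exact hmc.trans (mlcm_mono (Finset.filter_subset _ _))

theorem isConnected_inter_of_saturation_eq (hM : ∀ m ∈ M, ∃ i, m i ≠ 0) (hSM : S ⊆ M)
    (h : saturation M S = M) {C : Finset (Mon σ)} (hC : C ∈ components M) :
    IsConnected (C ∩ S) := by
  have hcov := saturation_eq_self_iff.1 h
  obtain ⟨m, hm, rfl⟩ := mem_components.1 hC
  constructor
  · obtain ⟨c, -, hmc⟩ := hcov m hm
    obtain ⟨i, hi⟩ := hM m hm
    obtain ⟨s, hs, hsi⟩ := exists_mem_apply_ne_zero_of_le_mlcm hi hmc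
    have hsS := (mem_compOf.1 hs).2.1
    exact ⟨s, Finset.mem_inter.2
      ⟨mem_compOf.2 (.of_ncf hm (hSM hsS) ⟨i, hi, hsi⟩), hsS⟩⟩
  · intro a ha b hb
    rw [Finset.mem_inter, mem_compOf] at ha hb
    have hle := le_mlcm_compOf_of_connIn hcov ha.2 (ha.1.symm.trans hb.1)
    obtain ⟨i, hi⟩ := hM b (hSM hb.2)
    obtain ⟨s, hs, hsi⟩ := exists_mem_apply_ne_zero_of_le_mlcm hi hle
    rw [mem_compOf] at hs
    exact .compOf_inter hSM ha.1 (hs.trans (.of_ncf hs.2.1 hb.2 ⟨i, hsi, hi⟩))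

theorem saturation_eq_of_isConnected_inter (hSM : S ⊆ M) (hlcm : mlcm S = mlcm M)
    (hconn : ∀ C ∈ components M, IsConnected (C ∩ S)) : saturation M S = M := by
  refine saturation_eq_self_iff.2 fun m hm => ?_
  obtain ⟨⟨a, ha⟩, hab⟩ := hconn _ (mem_components.2 ⟨m, hm, rfl⟩)
  refine ⟨a, (Finset.mem_inter.1 ha).2, fun i => ?_⟩
  by_cases hi : m i = 0
  · simp [hi]
  obtain ⟨s, hs, hle⟩ := exists_mem_le_apply_of_le_mlcm hi ((le_mlcm hm i).trans_eq
    (congrFun hlcm i).symm)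
  have hms : ConnIn M m s := .of_ncf hm (hSM hs) ⟨i, hi, by omega⟩
  have has := hab a ha s (Finset.mem_inter.2 ⟨mem_compOf.2 hms, hs⟩)
  exact hle.trans (le_mlcm (mem_compOf.2 (has.mono Finset.inter_subset_right)) i)

theorem saturation_eq_iff (hM : ∀ m ∈ M, ∃ i, m i ≠ 0) (hSM : S ⊆ M) :
    saturation M S = M ↔
      mlcm S = mlcm M ∧ ∀ C ∈ components M, IsConnected (C ∩ S) :=
  ⟨fun h => ⟨mlcm_eq_of_saturation_eq hSM h,
    fun _ hC => isConnected_inter_of_saturation_eq hM hSM h hC⟩,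
    fun h => saturation_eq_of_isConnected_inter hSM h.1 h.2⟩

end MonomialRings

/-- **Lemma (non-spanning subsets and `Δ'_M`).**
Let `M` be a finite monomial set (of monomials of degree at least 2).  Then
`{S ⊆ M : S̄ ≠ M} = Δ'_M`: the saturation of `S ⊆ M` is a proper subset of `M` if and
only if `m_S ≠ m_M` or `S ∩ Mᵢ` is disconnected for some connected component `Mᵢ` of
`M`. -/
theorem saturation_proper_iff_dprime
    (t : ℕ)
    (M : Finset (Mon (Fin t)))
    (hdeg : ∀ m ∈ M, 2 ≤ mdeg m) :
    {S : Finset (Mon (Fin t)) | S ⊆ M ∧ saturation M S ≠ M} = dprime M := by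
  ext S
  simp only [dprime, Set.mem_ofPred_eq, and_congr_right_iff]
  intro hSM
  rw [Ne, saturation_eq_iff (fun m hm => exists_ne_zero_of_two_le_mdeg (hdeg m hm)) hSM,
    not_and_or]
  push Not
  rfl
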